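/- arXiv:2203.13433 — 5 statements merged into one kernel-verified Lean document; each statement's English description precedes it below -/
import Mathlib

section
/- Let A = [a_1, …, a_K] be an M×K complex matrix with full column rank, let P = diag(p_1, …, p_K) with p_k > 0 for all k. Then for every k ∈ {1, …, K}, the quadratic form a_k^H (A P A^H + σ I)^{-1} a_k tends to p_k^{-1} as σ → 0 from the right. (Lemma 1, second part.) -/
open Matrix Filter

open scoped ComplexOrder in
lemma aux_unit {M K : ℕ} (A : Matrix (Fin M) (Fin K) ℂ)
    (p : Fin K → ℝ) (hp : ∀ k, 0 < p k) (σ : ℝ) (hσ : 0 < σ) :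
    IsUnit (A * Matrix.diagonal (fun j => (p j : ℂ)) * Aᴴ
      + (σ : ℂ) • (1 : Matrix (Fin M) (Fin M) ℂ)).det := by
  have h1 : (Matrix.diagonal (fun j => (p j : ℂ))).PosSemidef :=
    Matrix.PosSemidef.diagonal (fun j => by simpa using (hp j).le)
  have h2 := h1.mul_mul_conjTranspose_same A
  have h3 : ((σ : ℂ) • (1 : Matrix (Fin M) (Fin M) ℂ)).PosDef :=
    Matrix.PosDef.one.smul (by simpa using hσ)
  exact (Matrix.isUnit_iff_isUnit_det _).1 (Matrix.PosDef.posSemidef_add h2 h3).isUnit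

lemma aux_gram {M K : ℕ} (A : Matrix (Fin M) (Fin K) ℂ) (hA : A.rank = K) :
    (Aᴴ * A).det ≠ 0 := by
  open scoped ComplexOrder in
  have h : (Aᴴ * A).rank = K := by rw [Matrix.rank_conjTranspose_mul_self, hA]
  have hu : IsUnit (Aᴴ * A) := by
    rw [← Matrix.mulVec_surjective_iff_isUnit]
    have : LinearMap.range (Aᴴ * A).mulVecLin = ⊤ := by
      apply Submodule.eq_top_of_finrank_eq
      rw [Module.finrank_fin_fun]
      exact h
    exact LinearMap.range_eq_top.1 this
  exact ((Matrix.isUnit_iff_isUnit_det _).1 hu).ne_zero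

/-- If `A` has full column rank and `P = diag p` with `p k > 0`, then
`a_kᴴ (A P Aᴴ + σ I)⁻¹ a_k → (p k)⁻¹` as `σ → 0⁺`. -/
theorem stmt1 {M K : ℕ} (A : Matrix (Fin M) (Fin K) ℂ) (hA : A.rank = K)
    (p : Fin K → ℝ) (hp : ∀ k, 0 < p k) (k : Fin K) :
    Tendsto (fun σ : ℝ =>
        (star (fun i => A i k) ⬝ᵥ
          ((A * Matrix.diagonal (fun j => (p j : ℂ)) * Aᴴ + (σ : ℂ) • (1 : Matrix (Fin M) (Fin M) ℂ))⁻¹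
            *ᵥ (fun i => A i k))).re)
      (nhdsWithin 0 (Set.Ioi 0)) (nhds (p k)⁻¹) := by
  have hG := aux_gram A hA
  set P : Matrix (Fin K) (Fin K) ℂ := Matrix.diagonal (fun j => (p j : ℂ)) with hP
  have hPd : P.det ≠ 0 := by
    rw [hP, Matrix.det_diagonal]
    exact Finset.prod_ne_zero_iff.2 (fun j _ => by exact_mod_cast (hp j).ne')
  let S : ℝ → Matrix (Fin K) (Fin K) ℂ := fun σ => P * (Aᴴ * A) + (σ : ℂ) • 1
  have hS0 : S 0 = P * (Aᴴ * A) := by simp [S]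
  have hSd : (S 0).det ≠ 0 := by
    rw [hS0, Matrix.det_mul]; exact mul_ne_zero hPd hG
  have hSc : Continuous S := by
    simp only [S]
    fun_prop
  have hSdc : Continuous (fun σ => (S σ).det) := hSc.matrix_det
  have hinv : ContinuousAt (fun σ => (S σ)⁻¹) 0 := by
    simp only [Matrix.inv_def, Ring.inverse_eq_inv']
    exact (hSdc.continuousAt.inv₀ hSd).smul hSc.matrix_adjugate.continuousAt
  have hlim : ContinuousAt (fun σ => (((Aᴴ * A) * (S σ)⁻¹) k k).re) 0 := by
    have h1 : ContinuousAt (fun σ => (Aᴴ * A) * (S σ)⁻¹) 0 :=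
      ContinuousAt.comp (f := fun σ => (S σ)⁻¹) (g := fun X => (Aᴴ * A) * X)
        (by fun_prop) hinv
    exact Complex.continuous_re.continuousAt.comp
      (((continuous_apply_apply k k).continuousAt).comp h1)
  have hval : (((Aᴴ * A) * (S 0)⁻¹) k k).re = (p k)⁻¹ := by
    rw [hS0, Matrix.mul_inv_rev, ← Matrix.mul_assoc,
      Matrix.mul_nonsing_inv _ (isUnit_iff_ne_zero.2 hG), Matrix.one_mul]
    have : P⁻¹ = Matrix.diagonal (fun j => ((p j : ℂ))⁻¹) := by
      apply Matrix.inv_eq_right_inv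
      rw [hP, Matrix.diagonal_mul_diagonal, ← Matrix.diagonal_one]
      congr 1
      funext j
      exact mul_inv_cancel₀ (by exact_mod_cast (hp j).ne')
    rw [this, Matrix.diagonal_apply_eq, ← Complex.ofReal_inv, Complex.ofReal_re]
  have hT := hlim.tendsto
  rw [hval] at hT
  refine (hT.mono_left nhdsWithin_le_nhds).congr' ?_
  have hev : ∀ᶠ σ in nhdsWithin (0:ℝ) (Set.Ioi 0), (S σ).det ≠ 0 :=
    (hSdc.continuousAt.eventually_ne hSd).filter_mono nhdsWithin_le_nhds
  filter_upwards [hev, self_mem_nhdsWithin] with σ h1 h2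
  have hR := aux_unit A p hp σ h2
  rw [← hP] at hR
  set R := A * P * Aᴴ + (σ : ℂ) • (1 : Matrix (Fin M) (Fin M) ℂ) with hRdef
  have hpush : R * A = A * S σ := by
    simp only [hRdef, S, Matrix.add_mul, Matrix.mul_add, Matrix.mul_assoc,
      Matrix.smul_mul, Matrix.mul_smul, Matrix.one_mul, Matrix.mul_one]
  have hpush2 : R⁻¹ * A = A * (S σ)⁻¹ := by
    calc R⁻¹ * A = R⁻¹ * (A * S σ * (S σ)⁻¹) := by
          rw [Matrix.mul_assoc A, Matrix.mul_nonsing_inv _ (isUnit_iff_ne_zero.2 h1), Matrix.mul_one]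
      _ = (R⁻¹ * R) * (A * (S σ)⁻¹) := by rw [← hpush]; simp only [Matrix.mul_assoc]
      _ = A * (S σ)⁻¹ := by rw [Matrix.nonsing_inv_mul _ hR, Matrix.one_mul]
  rw [Matrix.mul_assoc, ← hpush2]
  rfl
end

section
/- Let A = [a_1, …, a_K] be an M×K complex matrix with full column rank, let P = diag(p_1, …, p_K) with p_k > 0 for all k, fix k ∈ {1, …, K} and ε > 0, and let D = diag(p_1, …, p_{k-1}, −ε, p_{k+1}, …, p_K). Then (i) the Hermitian matrix A D A^H has a strictly negative smallest eigenvalue λ_min(A D A^H) < 0, and (ii) for every σ with 0 < σ < −λ_min(A D A^H), one has (p_k + ε)^{-1} < a_k^H (A P A^H + σ I)^{-1} a_k. (Key step in the proof of Lemma 1.) -/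
open Matrix
open scoped ComplexOrder

/-- With `A` of full column rank, `P = diag p`, `p j > 0`, fix `k` and `ε > 0`, and let
`D` be `P` with the `k`-th diagonal entry replaced by `-ε`.  Then (i) the smallest eigenvalue of the
Hermitian matrix `A D Aᴴ` is strictly negative, and (ii) for every `σ` with
`0 < σ < -λ_min(A D Aᴴ)` one has `(p k + ε)⁻¹ < a_kᴴ (A P Aᴴ + σ I)⁻¹ a_k`. -/
theorem stmt2 {M K : ℕ} (A : Matrix (Fin M) (Fin K) ℂ) (hA : A.rank = K)
    (p : Fin K → ℝ) (hp : ∀ j, 0 < p j) (k : Fin K) (ε : ℝ) (hε : 0 < ε)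
    (D : Matrix (Fin K) (Fin K) ℂ)
    (hD : D = Matrix.diagonal (fun j => if j = k then (-ε : ℂ) else (p j : ℂ)))
    (hB : (A * D * Aᴴ).IsHermitian) :
    (⨅ i, hB.eigenvalues i) < 0 ∧
    ∀ σ : ℝ, 0 < σ → σ < -(⨅ i, hB.eigenvalues i) →
      ((p k + ε)⁻¹ : ℝ) <
        (star (fun i => A i k) ⬝ᵥ
          ((A * Matrix.diagonal (fun j => (p j : ℂ)) * Aᴴ + (σ : ℂ) • (1 : Matrix (Fin M) (Fin M) ℂ))⁻¹
            *ᵥ (fun i => A i k))).re := by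
  classical
  have hneg : (⨅ i, hB.eigenvalues i) < 0 := by
    have hsurj : ∃ x : Fin M → ℂ, Aᴴ *ᵥ x = Pi.single k 1 := by
      have h1 : Aᴴ.rank = K := by rw [rank_conjTranspose, hA]
      have h2 : LinearMap.range Aᴴ.mulVecLin = ⊤ := by
        apply Submodule.eq_top_of_finrank_eq
        simpa [Matrix.rank] using h1
      exact LinearMap.range_eq_top.mp h2 _
    obtain ⟨x, hx⟩ := hsurj
    by_contra hcon
    push Not at hcon
    have hps : (A * D * Aᴴ).PosSemidef := by
      rw [hB.posSemidef_iff_eigenvalues_nonneg]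
      intro i
      exact hcon.trans (ciInf_le (Set.finite_range _).bddBelow i)
    have h3 := hps.dotProduct_mulVec_nonneg x
    have h4 : star x ⬝ᵥ ((A * D * Aᴴ) *ᵥ x) = -(ε : ℂ) := by
      have h5 : star x ᵥ* A = star (Aᴴ *ᵥ x) := by
        rw [star_mulVec, conjTranspose_conjTranspose]
      rw [← mulVec_mulVec, ← mulVec_mulVec, dotProduct_mulVec, h5, hx, hD]
      simp
    rw [h4] at h3
    have := (Complex.le_def.mp h3).1
    simp at this
    linarith
  refine ⟨hneg, fun σ hσ hlt => ?_⟩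
  have hne : Nonempty (Fin M) := by
    by_contra h
    rw [not_nonempty_iff] at h
    simp [Real.iInf_of_isEmpty] at hneg
  obtain ⟨i, hi⟩ := exists_lt_of_ciInf_lt (lt_neg.mp hlt)
  set a : Fin M → ℂ := fun i => A i k with ha
  set R := A * Matrix.diagonal (fun j => (p j : ℂ)) * Aᴴ + (σ : ℂ) • (1 : Matrix (Fin M) (Fin M) ℂ) with hR
  have hRpd : R.PosDef := by
    apply Matrix.PosDef.posSemidef_add
    · apply Matrix.PosSemidef.mul_mul_conjTranspose_same
      apply Matrix.PosSemidef.diagonal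
      intro j
      simpa using (hp j).le
    · apply Matrix.PosDef.smul Matrix.PosDef.one
      simpa using hσ
  have hc : 0 < p k + ε := by linarith [hp k]
  set lam := hB.eigenvalues i with hlam
  set v : Fin M → ℂ := WithLp.ofLp (hB.eigenvectorBasis i) with hv
  have hBv : (A * D * Aᴴ) *ᵥ v = (lam : ℂ) • v := by
    have := hB.mulVec_eigenvectorBasis i
    rw [this]; ext j; simp [hv, hlam]
  have hvne : v ≠ 0 := by
    intro h
    apply hB.eigenvectorBasis.toBasis.ne_zero i
    ext j
    simpa using congrFun h j
  set t := star a ⬝ᵥ v with ht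
  have hRv : R *ᵥ v = ((p k + ε : ℝ) * t : ℂ) • a + ((lam + σ : ℝ) : ℂ) • v := by
    have hRe : R = A * D * Aᴴ + ((p k + ε : ℝ) : ℂ) • vecMulVec a (star a) + (σ : ℂ) • 1 := by
      rw [hR]
      congr 1
      ext r c
      have key : ∀ f : Fin K → ℂ, (A * Matrix.diagonal f * Aᴴ) r c
          = ∑ j, A r j * f j * star (A c j) := by
        intro f
        rw [Matrix.mul_apply]
        simp only [Matrix.mul_diagonal, conjTranspose_apply]
      rw [hD, Matrix.add_apply, key, key, Matrix.smul_apply, vecMulVec_apply, ← sub_eq_iff_eq_add',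
        ← Finset.sum_sub_distrib, Finset.sum_eq_single k]
      · simp [ha]
        ring
      · intro j _ hj
        simp [hj]
      · simp
    rw [hRe, add_mulVec, add_mulVec, hBv, smul_mulVec, smul_mulVec, one_mulVec, vecMulVec_mulVec, ← ht]
    ext j
    simp
    ring
  have hdet : IsUnit R.det := (Matrix.isUnit_iff_isUnit_det _).mp hRpd.isUnit
  set u := R⁻¹ *ᵥ a with hu
  have hRu : R *ᵥ u = a := by
    rw [hu, mulVec_mulVec, Matrix.mul_nonsing_inv _ hdet, one_mulVec]
  have hsym : ∀ x y : Fin M → ℂ, star x ⬝ᵥ (R *ᵥ y) = star (R *ᵥ x) ⬝ᵥ y := by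
    intro x y
    rw [dotProduct_mulVec, star_mulVec, hRpd.1.eq]
  set s := star a ⬝ᵥ u with hs
  have hua : star u ⬝ᵥ a = s := by
    rw [← hRu, hsym, hRu]
  have huv : t = ((p k + ε : ℝ) * t : ℂ) * s + ((lam + σ : ℝ) : ℂ) * (star u ⬝ᵥ v) := by
    have h := hsym u v
    rw [hRu, hRv, dotProduct_add, dotProduct_smul, dotProduct_smul, hua] at h
    simpa using h.symm
  have hw := hRpd.posSemidef.dotProduct_mulVec_nonneg (v - ((p k + ε : ℝ) * t : ℂ) • u)
  have hw2 : star (v - ((p k + ε : ℝ) * t : ℂ) • u) ⬝ᵥ (R *ᵥ (v - ((p k + ε : ℝ) * t : ℂ) • u))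
      = ((lam + σ : ℝ) : ℂ) * (star v ⬝ᵥ v) - ((p k + ε : ℝ) : ℂ) * (star t * t) * (1 - ((p k + ε : ℝ) : ℂ) * s) := by
    rw [mulVec_sub, mulVec_smul, hRv, hRu, add_sub_cancel_left, dotProduct_smul, star_sub,
      sub_dotProduct, star_smul, smul_dotProduct]
    simp only [smul_eq_mul, star_mul', Complex.star_def, Complex.conj_ofReal]
    linear_combination (((p k + ε : ℝ) : ℂ) * (starRingEnd ℂ) t) * huv
  rw [hw2] at hw
  have hvv : 0 < (star v ⬝ᵥ v).re := (Complex.lt_def.mp (dotProduct_star_self_pos_iff.mpr hvne)).1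
  have htt : star t * t = ((Complex.normSq t : ℝ) : ℂ) := by
    rw [Complex.normSq_eq_conj_mul_self]; rfl
  rw [htt] at hw
  have hre := (Complex.le_def.mp hw).1
  rw [← Complex.ofReal_mul, Complex.sub_re, Complex.re_ofReal_mul, Complex.re_ofReal_mul,
    Complex.sub_re, Complex.re_ofReal_mul, Complex.one_re, Complex.zero_re] at hre
  have hn := Complex.normSq_nonneg t
  rw [inv_lt_iff_one_lt_mul₀ hc]
  by_contra hcon
  push Not at hcon
  have h6 : 0 ≤ (p k + ε) * Complex.normSq t * (1 - (p k + ε) * s.re) :=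
    mul_nonneg (mul_nonneg hc.le hn) (by linarith)
  have h7 : (lam + σ) * (star v ⬝ᵥ v).re < 0 := mul_neg_of_neg_of_pos (by linarith) hvv
  linarith
end

section
/- Let A be an M×K complex matrix, P = diag(p_1, …, p_K) with p_k > 0 for all k, σ > 0, and Y an M×L complex matrix. Then tr(Y^H (A P A^H + σ I)^{-1} Y) is the minimum over all K×L complex matrices S of tr(S^H P^{-1} S) + σ^{-1} ‖Y − A S‖_F²; moreover the minimum is attained at S = P A^H (A P A^H + σ I)^{-1} Y. (Variational characterization used in the proof of Theorem 1, equation (47).) -/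
open Matrix

/-- The Frobenius norm of a complex matrix. -/
noncomputable def frob {m n : ℕ} (X : Matrix (Fin m) (Fin n) ℂ) : ℝ :=
  Real.sqrt (∑ i, ∑ j, ‖X i j‖ ^ 2)

theorem frob_sq_eq {m n : ℕ} (X : Matrix (Fin m) (Fin n) ℂ) :
    (frob X) ^ 2 = (Xᴴ * X).trace.re := by
  unfold frob
  rw [Real.sq_sqrt (by positivity), Finset.sum_comm]
  simp only [Matrix.trace, Matrix.diag, Matrix.mul_apply, Matrix.conjTranspose_apply,
    Complex.re_sum]
  refine Finset.sum_congr rfl fun j _ => Finset.sum_congr rfl fun i _ => ?_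
  rw [← Complex.normSq_eq_norm_sq, Complex.normSq_apply]
  simp

theorem key_identity {M K L : ℕ} (A : Matrix (Fin M) (Fin K) ℂ)
    (P Q : Matrix (Fin K) (Fin K) ℂ) (hPQ : P * Q = 1) (hQP : Q * P = 1) (hP : Pᴴ = P)
    (σ : ℝ) (hσ : 0 < σ) (Y Z : Matrix (Fin M) (Fin L) ℂ)
    (hY : Y = A * (P * (Aᴴ * Z)) + (σ : ℂ) • Z) (D : Matrix (Fin K) (Fin L) ℂ) :
    (P * (Aᴴ * Z) + D)ᴴ * Q * (P * (Aᴴ * Z) + D)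
      + (σ : ℂ)⁻¹ • ((Y - A * (P * (Aᴴ * Z) + D))ᴴ * (Y - A * (P * (Aᴴ * Z) + D)))
    = Yᴴ * Z + Dᴴ * Q * D + (σ : ℂ)⁻¹ • ((A * D)ᴴ * (A * D)) := by
  have hs : (σ : ℂ) ≠ 0 := by exact_mod_cast hσ.ne'
  have h1 : Y - A * (P * (Aᴴ * Z) + D) = (σ : ℂ) • Z - A * D := by
    rw [hY, Matrix.mul_add]; abel
  have h2 : Q * (P * (Aᴴ * Z) + D) = Aᴴ * Z + Q * D := by
    rw [Matrix.mul_add, ← Matrix.mul_assoc, hQP, Matrix.one_mul]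
  have h3 : ∀ W : Matrix (Fin K) (Fin L) ℂ, P * (Q * W) = W := fun W => by
    rw [← Matrix.mul_assoc, hPQ, Matrix.one_mul]
  rw [h1, Matrix.mul_assoc, h2, hY]
  simp only [Matrix.conjTranspose_add, Matrix.conjTranspose_sub, Matrix.conjTranspose_mul,
    Matrix.conjTranspose_smul, Matrix.conjTranspose_conjTranspose, hP, Matrix.mul_add,
    Matrix.add_mul, Matrix.mul_sub, Matrix.sub_mul, Matrix.mul_assoc, h3, Matrix.smul_mul,
    Matrix.mul_smul, smul_sub, smul_smul, Complex.star_def, Complex.conj_ofReal,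
    inv_mul_cancel₀ hs, one_smul, inv_mul_cancel_left₀ hs]
  abel

open scoped ComplexOrder in
theorem key_real {M K L : ℕ} (A : Matrix (Fin M) (Fin K) ℂ) (p : Fin K → ℝ)
    (hp : ∀ k, 0 < p k) (σ : ℝ) (hσ : 0 < σ) (Y : Matrix (Fin M) (Fin L) ℂ)
    (D : Matrix (Fin K) (Fin L) ℂ) (C : Matrix (Fin M) (Fin M) ℂ)
    (hC : C = A * Matrix.diagonal (fun k => (p k : ℂ)) * Aᴴ
      + (σ : ℂ) • (1 : Matrix (Fin M) (Fin M) ℂ))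
    (S : Matrix (Fin K) (Fin L) ℂ)
    (hS : S = Matrix.diagonal (fun k => (p k : ℂ)) * Aᴴ * C⁻¹ * Y + D) :
    (Sᴴ * Matrix.diagonal (fun k => ((p k)⁻¹ : ℂ)) * S).trace.re + σ⁻¹ * (frob (Y - A * S)) ^ 2
    = (Yᴴ * C⁻¹ * Y).trace.re + (Dᴴ * Matrix.diagonal (fun k => ((p k)⁻¹ : ℂ)) * D).trace.re
      + σ⁻¹ * (frob (A * D)) ^ 2 := by
  have hpc : ∀ k, (p k : ℂ) ≠ 0 := fun k => by exact_mod_cast (hp k).ne'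
  have hpos : C.PosDef := by
    rw [hC]
    refine Matrix.PosDef.posSemidef_add ?_ ?_
    · refine Matrix.PosSemidef.mul_mul_conjTranspose_same ?_ A
      refine Matrix.PosSemidef.diagonal ?_
      intro k
      exact Complex.zero_le_real.2 (hp k).le
    · exact Matrix.PosDef.one.smul (Complex.zero_lt_real.2 hσ)
  have hdet : IsUnit C.det := (Matrix.isUnit_iff_isUnit_det _).1 hpos.isUnit
  have hY : Y = A * (Matrix.diagonal (fun k => (p k : ℂ)) * (Aᴴ * (C⁻¹ * Y)))
      + (σ : ℂ) • (C⁻¹ * Y) := by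
    have h : C * (C⁻¹ * Y) = Y := by
      rw [← Matrix.mul_assoc, Matrix.mul_nonsing_inv _ hdet, Matrix.one_mul]
    have h' : C * (C⁻¹ * Y) = A * (Matrix.diagonal (fun k => (p k : ℂ)) * (Aᴴ * (C⁻¹ * Y)))
      + (σ : ℂ) • (C⁻¹ * Y) := by
      generalize C⁻¹ * Y = Z
      rw [hC]
      simp [Matrix.add_mul, Matrix.mul_assoc]
    exact h.symm.trans h'
  have key := key_identity A (Matrix.diagonal (fun k => (p k : ℂ)))
    (Matrix.diagonal (fun k => ((p k)⁻¹ : ℂ))) (by simp [hpc]) (by simp [hpc])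
    (by
      rw [Matrix.diagonal_conjTranspose]
      congr 1
      ext k
      simp)
    σ hσ Y (C⁻¹ * Y) hY D
  have hS' : Matrix.diagonal (fun k => (p k : ℂ)) * (Aᴴ * (C⁻¹ * Y)) + D = S := by
    rw [hS]; simp only [Matrix.mul_assoc]
  rw [hS'] at key
  have t := congrArg (fun X => X.trace.re) key
  simp only [Matrix.trace_add, Matrix.trace_smul, Complex.add_re, smul_eq_mul,
    ← Complex.ofReal_inv, Complex.re_ofReal_mul, ← Matrix.mul_assoc Yᴴ] at t
  rw [frob_sq_eq, frob_sq_eq]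
  simpa using t

open scoped ComplexOrder in
theorem quad_nonneg {K L : ℕ} (p : Fin K → ℝ) (hp : ∀ k, 0 < p k)
    (D : Matrix (Fin K) (Fin L) ℂ) :
    0 ≤ (Dᴴ * Matrix.diagonal (fun k => ((p k)⁻¹ : ℂ)) * D).trace.re := by
  have h : (Matrix.diagonal (fun k => ((p k)⁻¹ : ℂ))).PosSemidef := by
    refine Matrix.PosSemidef.diagonal ?_
    intro k
    have := Complex.zero_le_real.2 (inv_pos.2 (hp k)).le
    simpa using this
  exact (Complex.le_def.1 (h.conjTranspose_mul_mul_same D).trace_nonneg).1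

/-- `tr(Yᴴ (A P Aᴴ + σ I)⁻¹ Y)` equals the minimum over `S` of
`tr(Sᴴ P⁻¹ S) + σ⁻¹ ‖Y - A S‖_F²`, attained at `S = P Aᴴ (A P Aᴴ + σ I)⁻¹ Y`. -/
theorem stmt7 {M K L : ℕ} (A : Matrix (Fin M) (Fin K) ℂ) (p : Fin K → ℝ)
    (hp : ∀ k, 0 < p k) (σ : ℝ) (hσ : 0 < σ) (Y : Matrix (Fin M) (Fin L) ℂ) :
    (∀ S : Matrix (Fin K) (Fin L) ℂ,
      (Yᴴ * (A * Matrix.diagonal (fun k => (p k : ℂ)) * Aᴴ + (σ : ℂ) • (1 : Matrix (Fin M) (Fin M) ℂ))⁻¹ * Y).trace.re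
        ≤ (Sᴴ * Matrix.diagonal (fun k => ((p k)⁻¹ : ℂ)) * S).trace.re + σ⁻¹ * (frob (Y - A * S)) ^ 2) ∧
    ((fun S : Matrix (Fin K) (Fin L) ℂ =>
        (Sᴴ * Matrix.diagonal (fun k => ((p k)⁻¹ : ℂ)) * S).trace.re + σ⁻¹ * (frob (Y - A * S)) ^ 2)
      (Matrix.diagonal (fun k => (p k : ℂ)) * Aᴴ *
        (A * Matrix.diagonal (fun k => (p k : ℂ)) * Aᴴ + (σ : ℂ) • (1 : Matrix (Fin M) (Fin M) ℂ))⁻¹ * Y)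
      = (Yᴴ * (A * Matrix.diagonal (fun k => (p k : ℂ)) * Aᴴ + (σ : ℂ) • (1 : Matrix (Fin M) (Fin M) ℂ))⁻¹ * Y).trace.re) := by
  constructor
  · intro S
    rw [key_real A p hp σ hσ Y (S - Matrix.diagonal (fun k => (p k : ℂ)) * Aᴴ *
      (A * Matrix.diagonal (fun k => (p k : ℂ)) * Aᴴ
        + (σ : ℂ) • (1 : Matrix (Fin M) (Fin M) ℂ))⁻¹ * Y) _ rfl S (by abel)]
    have h1 := quad_nonneg p hp (S - Matrix.diagonal (fun k => (p k : ℂ)) * Aᴴ *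
      (A * Matrix.diagonal (fun k => (p k : ℂ)) * Aᴴ
        + (σ : ℂ) • (1 : Matrix (Fin M) (Fin M) ℂ))⁻¹ * Y)
    rw [add_assoc]
    exact le_add_of_nonneg_right (add_nonneg h1 (by positivity))
  · have h := key_real A p hp σ hσ Y 0 _ rfl _ rfl
    simp only [add_zero] at h
    refine h.trans ?_
    simp [frob]
end

section
/- Let Y be an M×L complex matrix. Suppose A° is an M×K complex matrix with K < M, S° a K×L complex matrix with no zero row, P° = diag(p°_1, …, p°_K) with p°_k = ‖S°_k‖²/L where S°_k is the k-th row of S°, and σ° ∈ (0, 1] satisfies ‖Y − A° S°‖_F² = M L σ°. Let A* be an M×K complex matrix, P* = diag(p*_1, …, p*_K) with p*_k ≥ 0, and σ* > 0, and suppose the inequality ln det(A* P* A*^H + σ* I) + (1/L) tr(Y^H (A* P* A*^H + σ* I)^{-1} Y) ≤ ln det(A° P° A°^H + σ° I) + (1/L) tr(S°^H (P°)^{-1} S°) + (1/(L σ°)) ‖Y − A° S°‖_F² holds. Then σ* ≤ e^{1 + K/M} · Π_{k=1}^{K} (λ_k(A° P° A°^H) + 1)^{1/M} · (σ°)^{(M−K)/M}.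 (Quantitative bound (57) in the proof of Theorem 1, establishing σ* → 0 as σ° → 0.) -/
open Matrix

theorem aux_det {M : ℕ} (B : Matrix (Fin M) (Fin M) ℂ) (hB : B.IsHermitian) (σ : ℝ) :
    (B + (σ : ℂ) • (1 : Matrix (Fin M) (Fin M) ℂ)).det.re = ∏ i, (hB.eigenvalues i + σ) := by
  have h1 := congrArg (Polynomial.eval (-(σ : ℂ))) hB.charpoly_eq
  rw [Matrix.eval_charpoly, Polynomial.eval_prod] at h1
  have h2 : B + (σ : ℂ) • (1 : Matrix (Fin M) (Fin M) ℂ)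
      = -(Matrix.scalar (Fin M) (-(σ : ℂ)) - B) := by
    rw [Matrix.scalar_apply, ← Matrix.smul_one_eq_diagonal, neg_smul]
    abel
  have h3 : (B + (σ : ℂ) • (1 : Matrix (Fin M) (Fin M) ℂ)).det
      = ((∏ i, (hB.eigenvalues i + σ) : ℝ) : ℂ) := by
    rw [h2, Matrix.det_neg, h1, ← Finset.card_univ, ← Finset.prod_const, ← Finset.prod_mul_distrib]
    push_cast
    refine Finset.prod_congr rfl fun i _ => ?_
    simp [add_comm]
  rw [h3, Complex.ofReal_re]

open scoped ComplexOrder in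
theorem aux_psd {M K : ℕ} (A : Matrix (Fin M) (Fin K) ℂ) (p : Fin K → ℝ) (hp : ∀ k, 0 ≤ p k) :
    (A * Matrix.diagonal (fun k => (p k : ℂ)) * Aᴴ).PosSemidef := by
  refine Matrix.PosSemidef.mul_mul_conjTranspose_same ?_ A
  refine Matrix.PosSemidef.diagonal ?_
  intro k
  simpa using hp k

open scoped ComplexOrder in
theorem aux_zero {M K : ℕ} (hK : K < M) (B : Matrix (Fin M) (Fin M) ℂ) (hB : B.IsHermitian)
    (hps : B.PosSemidef) (hr : B.rank ≤ K) (lam : Fin M → ℝ) (hmono : Antitone lam)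
    (e : Fin M ≃ Fin M) (hlam : lam = hB.eigenvalues ∘ e) (j : Fin M) (hj : K ≤ j.1) :
    lam j = 0 := by
  by_contra hne
  have hnn : ∀ i, 0 ≤ lam i := fun i => by
    rw [hlam]; exact hps.eigenvalues_nonneg _
  have hpos : 0 < lam j := lt_of_le_of_ne (hnn j) (Ne.symm hne)
  rw [hB.rank_eq_card_non_zero_eigs] at hr
  let f : Fin (K + 1) → {i // hB.eigenvalues i ≠ 0} := fun i =>
    ⟨e (Fin.castLE hK i), by
      have h1 : lam j ≤ lam (Fin.castLE hK i) := hmono (by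
        rw [Fin.le_def]; simp; have := i.2; omega)
      have h2 : lam (Fin.castLE hK i) = hB.eigenvalues (e (Fin.castLE hK i)) := by
        rw [hlam]; rfl
      rw [← h2]
      linarith⟩
  have hf : Function.Injective f := by
    intro a b hab
    have := e.injective (congrArg Subtype.val hab)
    exact Fin.castLE_injective hK this
  have := Fintype.card_le_of_injective f hf
  simp only [Fintype.card_fin] at this
  omega

/-- bound (57) in the proof of Theorem 1: under the stated ground-truth and
near-optimality assumptions, `σ* ≤ e^{1 + K/M} ∏_{k=1}^{K} (λ_k(A°P°A°ᴴ) + 1)^{1/M} (σ°)^{(M-K)/M}`,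
where `lam` lists the eigenvalues of `A° P° A°ᴴ` in decreasing order. -/
theorem stmt11 {M K L : ℕ} (hK : K < M) (hL : 1 ≤ L)
    (Y : Matrix (Fin M) (Fin L) ℂ)
    (Ao : Matrix (Fin M) (Fin K) ℂ) (So : Matrix (Fin K) (Fin L) ℂ)
    (hSo : ∀ k, ∃ l, So k l ≠ 0)
    (po : Fin K → ℝ) (hpo : ∀ k, po k = (∑ l, ‖So k l‖ ^ 2) / (L : ℝ))
    (σo : ℝ) (hσo0 : 0 < σo) (hσo1 : σo ≤ 1)
    (hfid : (frob (Y - Ao * So)) ^ 2 = (M : ℝ) * (L : ℝ) * σo)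
    (As : Matrix (Fin M) (Fin K) ℂ) (ps : Fin K → ℝ) (hps : ∀ k, 0 ≤ ps k)
    (σs : ℝ) (hσs : 0 < σs)
    (hBo : (Ao * Matrix.diagonal (fun k => (po k : ℂ)) * Aoᴴ).IsHermitian)
    (lam : Fin M → ℝ) (hmono : Antitone lam)
    (e : Fin M ≃ Fin M) (hlam : lam = hBo.eigenvalues ∘ e)
    (hineq :
      Real.log (As * Matrix.diagonal (fun k => (ps k : ℂ)) * Asᴴ + (σs : ℂ) • (1 : Matrix (Fin M) (Fin M) ℂ)).det.re
          + (1 / (L : ℝ)) * (Yᴴ *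
              (As * Matrix.diagonal (fun k => (ps k : ℂ)) * Asᴴ + (σs : ℂ) • (1 : Matrix (Fin M) (Fin M) ℂ))⁻¹ *
              Y).trace.re
        ≤ Real.log (Ao * Matrix.diagonal (fun k => (po k : ℂ)) * Aoᴴ + (σo : ℂ) • (1 : Matrix (Fin M) (Fin M) ℂ)).det.re
          + (1 / (L : ℝ)) * (Soᴴ * Matrix.diagonal (fun k => ((po k)⁻¹ : ℂ)) * So).trace.re
          + (1 / ((L : ℝ) * σo)) * (frob (Y - Ao * So)) ^ 2) :
    σs ≤ Real.exp (1 + (K : ℝ) / (M : ℝ))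
        * (∏ k : Fin K, (lam (Fin.castLE hK.le k) + 1) ^ ((1 : ℝ) / (M : ℝ)))
        * σo ^ (((M : ℝ) - (K : ℝ)) / (M : ℝ)) := by
  open scoped ComplexOrder in
  have hL0 : (0 : ℝ) < L := by exact_mod_cast hL
  have hM0 : (0 : ℝ) < M := by exact_mod_cast (by omega : 0 < M)
  have hsum : ∀ k, 0 < ∑ l, ‖So k l‖ ^ 2 := by
    intro k
    obtain ⟨l, hl⟩ := hSo k
    refine Finset.sum_pos' (fun _ _ => by positivity) ⟨l, Finset.mem_univ _, ?_⟩
    have := norm_pos_iff.mpr hl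
    positivity
  have hpo0 : ∀ k, 0 < po k := fun k => by rw [hpo]; exact div_pos (hsum k) hL0
  have hpsdo := aux_psd Ao po (fun k => (hpo0 k).le)
  have hpsds := aux_psd As ps hps
  -- trace term on the right
  have htr : (1 / (L : ℝ)) * (Soᴴ * Matrix.diagonal (fun k => ((po k)⁻¹ : ℂ)) * So).trace.re = K := by
    have h1 : (Soᴴ * Matrix.diagonal (fun k => ((po k)⁻¹ : ℂ)) * So).trace
        = (((K : ℝ) * L : ℝ) : ℂ) := by
      rw [Matrix.mul_assoc, Matrix.trace_mul_comm, Matrix.mul_assoc, Matrix.trace]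
      simp only [Matrix.diag_apply, Matrix.diagonal_mul]
      have h2 : ∀ k, (So * Soᴴ) k k = ((L * po k : ℝ) : ℂ) := by
        intro k
        rw [hpo, mul_div_cancel₀ _ hL0.ne', Matrix.mul_apply]
        push_cast
        refine Finset.sum_congr rfl fun l _ => ?_
        rw [Matrix.conjTranspose_apply]
        exact Complex.mul_conj' _
      have h3 : ∀ k, ((po k : ℂ))⁻¹ * (So * Soᴴ) k k = (L : ℂ) := by
        intro k
        have : (po k : ℂ) ≠ 0 := by exact_mod_cast (hpo0 k).ne'
        rw [h2]; push_cast; field_simp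
      simp [h3]
    rw [h1, Complex.ofReal_re]
    field_simp
  have hfr : (1 / ((L : ℝ) * σo)) * (frob (Y - Ao * So)) ^ 2 = M := by
    rw [hfid]; field_simp
  -- left-hand side
  have hC : (As * Matrix.diagonal (fun k => (ps k : ℂ)) * Asᴴ
      + (σs : ℂ) • (1 : Matrix (Fin M) (Fin M) ℂ)).PosDef := by
    refine Matrix.PosDef.posSemidef_add hpsds ?_
    exact Matrix.PosDef.one.smul (by exact_mod_cast hσs)
  have htr2 : 0 ≤ (Yᴴ * (As * Matrix.diagonal (fun k => (ps k : ℂ)) * Asᴴ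
      + (σs : ℂ) • (1 : Matrix (Fin M) (Fin M) ℂ))⁻¹ * Y).trace.re := by
    have := (hC.inv.posSemidef.conjTranspose_mul_mul_same Y).trace_nonneg
    exact (Complex.le_def.mp this).1
  have hdet1 : (M : ℝ) * Real.log σs ≤ Real.log (As * Matrix.diagonal (fun k => (ps k : ℂ)) * Asᴴ
      + (σs : ℂ) • (1 : Matrix (Fin M) (Fin M) ℂ)).det.re := by
    rw [aux_det _ hpsds.1, ← Real.log_pow]
    refine Real.log_le_log (by positivity) ?_
    have : σs ^ M = ∏ i : Fin M, σs := by simp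
    rw [this]
    refine Finset.prod_le_prod (fun _ _ => hσs.le) fun i _ => ?_
    have := hpsds.eigenvalues_nonneg i
    linarith
  have hnn : ∀ i, 0 ≤ lam i := fun i => by
    rw [hlam]; exact hpsdo.eigenvalues_nonneg _
  have hr : (Ao * Matrix.diagonal (fun k => (po k : ℂ)) * Aoᴴ).rank ≤ K := by
    rw [Matrix.mul_assoc]
    refine (Matrix.rank_mul_le_left _ _).trans ?_
    simpa using Matrix.rank_le_width Ao
  have hz := aux_zero hK _ hBo hpsdo hr lam hmono e hlam
  have hdet2 : Real.log (Ao * Matrix.diagonal (fun k => (po k : ℂ)) * Aoᴴ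
      + (σo : ℂ) • (1 : Matrix (Fin M) (Fin M) ℂ)).det.re
      ≤ ∑ k : Fin K, Real.log (lam (Fin.castLE hK.le k) + 1) + ((M : ℝ) - K) * Real.log σo := by
    rw [aux_det _ hBo, ← Equiv.prod_comp e]
    have h1 : ∀ i, hBo.eigenvalues (e i) = lam i := fun i => by rw [hlam]; rfl
    simp only [h1]
    rw [Real.log_prod (fun i _ => by have := hnn i; positivity)]
    obtain ⟨N, rfl⟩ := Nat.exists_eq_add_of_le hK.le
    rw [Fin.sum_univ_add]
    refine add_le_add ?_ (le_of_eq ?_)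
    · refine Finset.sum_le_sum fun k _ => ?_
      have := hnn (Fin.castAdd N k)
      exact Real.log_le_log (by positivity) (by
        change lam (Fin.castAdd N k) + σo ≤ lam (Fin.castAdd N k) + 1
        linarith)
    · have : ∀ i : Fin N, lam (Fin.natAdd K i) = 0 := fun i => hz _ (by simp)
      simp [this]
  have hmain : (M : ℝ) * Real.log σs ≤ ∑ k : Fin K, Real.log (lam (Fin.castLE hK.le k) + 1)
      + ((M : ℝ) - K) * Real.log σo + K + M := by
    rw [htr, hfr] at hineq
    have : 0 ≤ (1 / (L : ℝ)) * (Yᴴ * (As * Matrix.diagonal (fun k => (ps k : ℂ)) * Asᴴ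
      + (σs : ℂ) • (1 : Matrix (Fin M) (Fin M) ℂ))⁻¹ * Y).trace.re :=
      mul_nonneg (by positivity) htr2
    linarith
  have hl1 : ∀ k : Fin K, 0 < lam (Fin.castLE hK.le k) + 1 := fun k => by
    have := hnn (Fin.castLE hK.le k)
    positivity
  have hp : ∀ k : Fin K, 0 < (lam (Fin.castLE hK.le k) + 1) ^ ((1 : ℝ) / (M : ℝ)) :=
    fun k => Real.rpow_pos_of_pos (hl1 k) _
  have hP : 0 < ∏ k : Fin K, (lam (Fin.castLE hK.le k) + 1) ^ ((1 : ℝ) / (M : ℝ)) :=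
    Finset.prod_pos fun k _ => hp k
  have hS : 0 < σo ^ (((M : ℝ) - (K : ℝ)) / (M : ℝ)) := Real.rpow_pos_of_pos hσo0 _
  rw [← Real.log_le_log_iff hσs (by positivity), Real.log_mul (by positivity) hS.ne',
    Real.log_mul (by positivity) hP.ne', Real.log_exp, Real.log_rpow hσo0,
    Real.log_prod (fun k _ => (hp k).ne')]
  simp only [Real.log_rpow (hl1 _)]
  rw [← Finset.mul_sum]
  refine le_of_mul_le_mul_left (hmain.trans (le_of_eq ?_)) hM0
  field_simp
  ring
end

section
/- Let A = [a_1, …, a_K] be an M×K complex matrix with a_k ≠ 0 for a fixed index k, let P = diag(p_1, …, p_K) with p_j > 0 for all j, σ > 0, let L ≥ 1 be an integer and s ∈ ℂ^L a row vector. If the stationarity equation a_k^H (A P A^H + σ I)^{-1} a_k = ‖s‖² / (L p_k²) holds, then p_k > ‖s‖² / L. (Final step (61)–(62) in the proof of Theorem 1, showing that the estimated source power strictly exceeds the empirical power of the corresponding signal row.) -/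
open Matrix

/-- If `a_k ≠ 0` and the stationarity equation
`a_kᴴ (A P Aᴴ + σ I)⁻¹ a_k = ‖s‖² / (L p_k²)` holds with `σ > 0`, then `p_k > ‖s‖² / L`. -/
theorem stmt13 {M K L : ℕ} (hL : 1 ≤ L) (A : Matrix (Fin M) (Fin K) ℂ) (k : Fin K)
    (hak : (fun i => A i k) ≠ 0) (p : Fin K → ℝ) (hp : ∀ j, 0 < p j)
    (σ : ℝ) (hσ : 0 < σ) (s : Fin L → ℂ)
    (hstat :
      (star (fun i => A i k) ⬝ᵥ
        ((A * Matrix.diagonal (fun j => (p j : ℂ)) * Aᴴ + (σ : ℂ) • (1 : Matrix (Fin M) (Fin M) ℂ))⁻¹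
          *ᵥ (fun i => A i k))).re
      = (∑ l, ‖s l‖ ^ 2) / ((L : ℝ) * (p k) ^ 2)) :
    (∑ l, ‖s l‖ ^ 2) / (L : ℝ) < p k := by
  set a : Fin M → ℂ := fun i => A i k with ha
  set R : Matrix (Fin M) (Fin M) ℂ :=
    A * Matrix.diagonal (fun j => (p j : ℂ)) * Aᴴ + (σ : ℂ) • (1 : Matrix (Fin M) (Fin M) ℂ) with hR
  open ComplexOrder in
  have hpd : R.PosDef := by
    have h1 : (Matrix.diagonal (fun j => (p j : ℂ))).PosSemidef :=
      Matrix.PosSemidef.diagonal (fun j => by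
        show (0 : ℂ) ≤ (p j : ℂ)
        exact_mod_cast (hp j).le)
    have h2 := h1.mul_mul_conjTranspose_same A
    have hs : (0 : ℂ) < (σ : ℂ) := by exact_mod_cast hσ
    exact Matrix.PosDef.posSemidef_add h2 (Matrix.PosDef.smul Matrix.PosDef.one hs)
  have hu : IsUnit R.det := (Matrix.isUnit_iff_isUnit_det R).1 hpd.isUnit
  set x : Fin M → ℂ := R⁻¹ *ᵥ a with hx
  have hRx : R *ᵥ x = a := by
    rw [hx, Matrix.mulVec_mulVec, Matrix.mul_nonsing_inv _ hu, Matrix.one_mulVec]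
  clear_value x
  have hx0 : x ≠ 0 := by
    intro h
    rw [h, Matrix.mulVec_zero] at hRx
    exact hak hRx.symm
  set w : Fin K → ℂ := Aᴴ *ᵥ x with hw
  have hwk : w k = star a ⬝ᵥ x := rfl
  have hexp : star a ⬝ᵥ x = ((∑ j, p j * Complex.normSq (w j) + σ * ∑ i, Complex.normSq (x i) : ℝ) : ℂ) := by
    have e1 : a = A *ᵥ (Matrix.diagonal (fun j => (p j : ℂ)) *ᵥ w) + (σ : ℂ) • x := by
      rw [← hRx, hR, Matrix.add_mulVec, Matrix.smul_mulVec, Matrix.one_mulVec, hw,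
        Matrix.mulVec_mulVec, Matrix.mulVec_mulVec]
    rw [e1, star_add, add_dotProduct, Matrix.star_mulVec, ← Matrix.dotProduct_mulVec, ← hw]
    push_cast
    congr 1
    · simp only [dotProduct, Pi.star_apply, Matrix.mulVec_diagonal]
      refine Finset.sum_congr rfl fun j _ => ?_
      simp [Complex.normSq_eq_conj_mul_self, mul_assoc]
    · simp only [dotProduct, Finset.mul_sum]
      refine Finset.sum_congr rfl fun j _ => ?_
      simp [Complex.normSq_eq_conj_mul_self, mul_assoc]
  have hsx : 0 < ∑ i, Complex.normSq (x i) := by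
    obtain ⟨i, hi⟩ := Function.ne_iff.1 hx0
    exact Finset.sum_pos' (fun i _ => Complex.normSq_nonneg _)
      ⟨i, Finset.mem_univ _, Complex.normSq_pos.2 hi⟩
  have hk : p k * Complex.normSq (w k) ≤ ∑ j, p j * Complex.normSq (w j) :=
    Finset.single_le_sum (f := fun j => p j * Complex.normSq (w j))
      (fun j _ => mul_nonneg (hp j).le (Complex.normSq_nonneg _)) (Finset.mem_univ k)
  set q : ℝ := (star a ⬝ᵥ x).re with hq
  have hq1 : q = ∑ j, p j * Complex.normSq (w j) + σ * ∑ i, Complex.normSq (x i) := by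
    rw [hq, hexp, Complex.ofReal_re]
  have hq2 : q ^ 2 ≤ Complex.normSq (w k) := by
    rw [hwk, Complex.normSq_apply, hq]
    nlinarith [mul_self_nonneg (star a ⬝ᵥ x).im]
  have hpk := hp k
  have hlt : p k * q ^ 2 < q := by
    have := mul_le_mul_of_nonneg_left hq2 hpk.le
    have := mul_pos hσ hsx
    linarith
  have hqpos : 0 < q := lt_of_le_of_lt (by positivity) hlt
  have hpq : p k * q < 1 := by
    by_contra h
    nlinarith [not_lt.1 h]
  have hLpos : (0 : ℝ) < L := by exact_mod_cast hL
  have hfin : (∑ l, ‖s l‖ ^ 2) / (L : ℝ) = q * p k ^ 2 := by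
    rw [hstat]
    field_simp
  rw [hfin]
  nlinarith
end
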